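/- Let p ≥ 2, X a type, and f : X → ℝ^p with f_i(x) > 0 for all x ∈ X and all i; let Y := f(X) and suppose Y↑ = conv(Y) + ℝ≥0^p is closed. Let S ⊆ X be any set with Y_ESN ⊆ f(S). Then S is an A-approximation of the problem: for every x' ∈ X there exist x ∈ S and α ∈ ℝ^p with α_i ≥ 1 for all i, α_j = 1 for at least one j, Σ_{i : α_i > 1} α_i = p, and f_i(x) ≤ α_i · f_i(x') for all i. -/

import Mathlib

open Set Pointwise Finset

/-- The set of points of `A` that are nondominated in `A` (componentwise order). -/
def nonDomPts (p : ℕ) (A : Set (Fin p → ℝ)) : Set (Fin p → ℝ) :=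
  {y | y ∈ A ∧ ∀ y' ∈ A, y' ≤ y → y' = y}

/-- The upper image `Y↑ = conv Y + ℝ≥0^p`. -/
def upImage (p : ℕ) (Y : Set (Fin p → ℝ)) : Set (Fin p → ℝ) :=
  convexHull ℝ Y + {r : Fin p → ℝ | 0 ≤ r}

/-- Extreme-supported nondominated points of `Y`. -/
def ESN (p : ℕ) (Y : Set (Fin p → ℝ)) : Set (Fin p → ℝ) :=
  {y | y ∈ nonDomPts p Y ∧ y ∈ Set.extremePoints ℝ (convexHull ℝ Y)}


lemma exists_min_ESN (p : ℕ) (Y : Set (Fin p → ℝ)) (hY : ∀ y ∈ Y, ∀ i, 0 < y i)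
    (hclosed : IsClosed (upImage p Y)) (y' : Fin p → ℝ) (hy' : y' ∈ Y)
    (w : Fin p → ℝ) (hw : ∀ i, 0 < w i) :
    ∃ y ∈ ESN p Y, ∑ i, w i * y i ≤ ∑ i, w i * y' i := by
  let L : (Fin p → ℝ) →L[ℝ] ℝ := ∑ i, w i • ContinuousLinearMap.proj i
  have hL : ∀ y, L y = ∑ i, w i * y i := by
    intro y; simp [L]
  have hsub : convexHull ℝ Y ⊆ upImage p Y := by
    intro c hc
    exact ⟨c, hc, 0, le_refl (0 : Fin p → ℝ), by simp⟩
  have hconv : convexHull ℝ Y ⊆ {y : Fin p → ℝ | 0 ≤ y} := by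
    refine convexHull_min (fun y hy i => (hY y hy i).le) (convex_Ici (0 : Fin p → ℝ))
  have hpos : ∀ y ∈ upImage p Y, 0 ≤ y := by
    rintro y ⟨c, hc, r, hr, rfl⟩
    exact add_nonneg (hconv hc) hr
  have hyP : y' ∈ upImage p Y := hsub (subset_convexHull ℝ Y hy')
  have hK : IsCompact (upImage p Y ∩ {y | L y ≤ L y'}) := by
    refine (isCompact_Icc (a := (0 : Fin p → ℝ)) (b := fun i => L y' / w i)).of_isClosed_subset
      (hclosed.inter (isClosed_le L.continuous continuous_const)) ?_
    rintro y ⟨hy, hle⟩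
    refine ⟨hpos y hy, fun i => ?_⟩
    rw [le_div_iff₀ (hw i), mul_comm]
    refine le_trans ?_ hle
    rw [hL]
    exact Finset.single_le_sum (f := fun i => w i * y i)
      (fun i _ => mul_nonneg (hw i).le (hpos y hy i)) (Finset.mem_univ i)
  obtain ⟨z, hz, hzmin⟩ := hK.exists_isMinOn ⟨y', hyP, le_refl (L y')⟩ L.continuous.continuousOn
  have hzmin' : ∀ y ∈ upImage p Y, L z ≤ L y := by
    intro y hy
    by_cases h : L y ≤ L y'
    · exact hzmin ⟨hy, h⟩
    · exact hz.2.trans (not_le.1 h).le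
  have hexp : IsExposed ℝ (upImage p Y) ((-L).toExposed (upImage p Y)) :=
    ContinuousLinearMap.toExposed.isExposed
  have hne : ((-L).toExposed (upImage p Y)).Nonempty :=
    ⟨z, hz.1, fun y hy => by simpa using hzmin' y hy⟩
  have hcomp : IsCompact ((-L).toExposed (upImage p Y)) := by
    refine hK.of_isClosed_subset (hexp.isClosed hclosed) ?_
    intro y hy
    exact ⟨hy.1, by simpa using hy.2 y' hyP⟩
  obtain ⟨y, hy⟩ := hcomp.extremePoints_nonempty hne
  have hyext : y ∈ extremePoints ℝ (upImage p Y) :=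
    hexp.isExtreme.extremePoints_subset_extremePoints hy
  have hymin : ∀ u ∈ upImage p Y, L y ≤ L u := fun u hu => by simpa using hy.1.2 u hu
  have hstrict : ∀ u ∈ upImage p Y, u ≤ y → u = y := by
    intro u hu huy
    have h1 := hymin u hu
    rw [hL, hL] at h1
    have h2 : ∀ i ∈ Finset.univ, w i * u i ≤ w i * y i :=
      fun i _ => mul_le_mul_of_nonneg_left (huy i) (hw i).le
    have h3 := (Finset.sum_eq_sum_iff_of_le h2).1 (le_antisymm (Finset.sum_le_sum h2) h1)
    funext i
    exact mul_left_cancel₀ (hw i).ne' (h3 i (Finset.mem_univ i))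
  have hyc : y ∈ convexHull ℝ Y := by
    obtain ⟨c, hc, r, hr, hcr⟩ := hyext.1
    have : c = y := hstrict c (hsub hc) (by
      rw [← hcr]; exact le_add_of_nonneg_right hr)
    exact this ▸ hc
  have hye : y ∈ extremePoints ℝ (convexHull ℝ Y) :=
    inter_extremePoints_subset_extremePoints_of_subset hsub ⟨hyc, hyext⟩
  refine ⟨y, ⟨⟨extremePoints_convexHull_subset hye, fun u hu huy =>
    hstrict u (hsub (subset_convexHull ℝ Y hu)) huy⟩, hye⟩, ?_⟩
  rw [← hL, ← hL]
  exact hymin y' hyP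

lemma exists_alpha (p : ℕ) (hp : 2 ≤ p) (r : Fin p → ℝ) (hr : ∀ i, 0 < r i)
    (hs : ∑ i, r i ≤ p) : ∃ α : Fin p → ℝ, (∀ i, 1 ≤ α i) ∧ (∃ j, α j = 1) ∧
      (∑ i ∈ Finset.univ.filter (fun i => 1 < α i), α i) = (p : ℝ) ∧ ∀ i, r i ≤ α i := by
  have hp' : (2 : ℝ) ≤ p := by exact_mod_cast hp
  haveI : Nontrivial (Fin p) := Fin.nontrivial_iff_two_le.2 hp
  obtain ⟨j, hj⟩ : ∃ j, r j ≤ 1 := by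
    by_contra! h
    have : ∑ i : Fin p, (1 : ℝ) < ∑ i, r i :=
      Finset.sum_lt_sum_of_nonempty Finset.univ_nonempty (fun i _ => h i)
    simp at this
    linarith
  obtain ⟨k, hkj, hk⟩ : ∃ k, k ≠ j ∧ ∀ i, 1 < r i → 1 < r k := by
    by_cases h : ∃ k, 1 < r k
    · obtain ⟨k, hk⟩ := h
      exact ⟨k, by rintro rfl; linarith, fun _ _ => hk⟩
    · push Not at h
      obtain ⟨k, hk⟩ := exists_ne j
      exact ⟨k, hk, fun i hi => absurd hi (not_lt.2 (h i))⟩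
  set T := (Finset.univ.filter (fun i => 1 < r i)).erase k with hT
  set s := ∑ i ∈ T, r i with hsdef
  have hkT : k ∉ T := Finset.notMem_erase k _
  have hsk : r k + s ≤ p := by
    rw [hsdef, ← Finset.sum_insert hkT]
    exact (Finset.sum_le_sum_of_subset_of_nonneg (Finset.subset_univ _)
      (fun i _ _ => (hr i).le)).trans hs
  have hk1 : 1 < p - s := by
    by_cases h : 1 < r k
    · linarith
    · have : T = ∅ := by
        ext i
        simp only [hT, Finset.mem_erase, Finset.mem_filter, Finset.notMem_empty, iff_false]
        rintro ⟨_, _, hi⟩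
        exact h (hk i hi)
      rw [hsdef, this, Finset.sum_empty]; linarith
  let α : Fin p → ℝ := fun i => if i = k then p - s else max 1 (r i)
  have hαk : α k = p - s := by simp [α]
  have hα : ∀ i, i ≠ k → α i = max 1 (r i) := fun i hi => by simp [α, hi]
  refine ⟨α, fun i => ?_, ⟨j, ?_⟩, ?_, fun i => ?_⟩
  · by_cases h : i = k
    · rw [h, hαk]; exact hk1.le
    · rw [hα i h]; exact le_max_left _ _
  · rw [hα j hkj.symm]; exact max_eq_left hj
  · have : Finset.univ.filter (fun i => 1 < α i) = insert k T := by
      ext i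
      by_cases h : i = k
      · subst h; simp [hαk, hk1]
      · simp [hT, h, hα i h]
    rw [this, Finset.sum_insert hkT, hαk]
    have : ∑ i ∈ T, α i = s := by
      refine Finset.sum_congr rfl fun i hi => ?_
      simp only [hT, Finset.mem_erase, Finset.mem_filter] at hi
      rw [hα i hi.1]; exact max_eq_right hi.2.2.le
    rw [this]; ring
  · by_cases h : i = k
    · rw [h, hαk]; linarith
    · rw [hα i h]; exact le_max_right _ _

theorem stmt_16 (p : ℕ) (hp : 2 ≤ p) (X : Type*) (f : X → Fin p → ℝ)
    (hf : ∀ (x : X) (i : Fin p), 0 < f x i)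
    (hclosed : IsClosed (upImage p (Set.range f)))
    (S : Set X) (hS : ESN p (Set.range f) ⊆ f '' S) :
    ∀ x' : X, ∃ x ∈ S, ∃ α : Fin p → ℝ, (∀ i, 1 ≤ α i) ∧ (∃ j, α j = 1) ∧
      (∑ i ∈ Finset.univ.filter (fun i => 1 < α i), α i) = (p : ℝ) ∧
      ∀ i, f x i ≤ α i * f x' i := by
  intro x'
  obtain ⟨y, hy, hle⟩ := exists_min_ESN p (Set.range f) (by rintro _ ⟨x, rfl⟩; exact hf x)
    hclosed (f x') ⟨x', rfl⟩ (fun i => (f x' i)⁻¹) (fun i => inv_pos.2 (hf x' i))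
  obtain ⟨x, hx, rfl⟩ := hS hy
  have h1 : ∑ i, (f x' i)⁻¹ * f x' i = (p : ℝ) := by
    rw [Finset.sum_congr rfl (fun i _ => inv_mul_cancel₀ (hf x' i).ne')]
    simp
  obtain ⟨α, ha, hb, hc, hd⟩ := exists_alpha p hp (fun i => (f x' i)⁻¹ * f x i)
    (fun i => mul_pos (inv_pos.2 (hf x' i)) (hf x i)) (hle.trans h1.le)
  refine ⟨x, hx, α, ha, hb, hc, fun i => ?_⟩
  have := hd i
  rwa [inv_mul_le_iff₀ (hf x' i), mul_comm] at this
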